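/- Let u be an ancient solution of the heat equation on ℝⁿ with polynomial growth of degree at most q ≥ 1, i.e. |u(x,t)| ≤ c₀(|x| + √|t| + 1)^q for all x ∈ ℝⁿ, t ≤ 0. If for some R > 0 and some (x₀,t₀) ∈ ℝⁿ × (-∞,0] one has ∫_{P_R(x₀,t₀)} u² dx dt = 0, then u is identically zero on ℝⁿ × (-∞,0]. In particular, for every R > 0 and every (x₀,t₀), the bilinear form (u,v) ↦ ∫_{P_R(x₀,t₀)} u v dx dt is an inner product on any finite-dimensional subspace of H^q(ℝⁿ × ℝ⁻). -/

import Mathlib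

open MeasureTheory Real

noncomputable section

/-- Spatial Laplacian of `f : ℝⁿ → ℝ` at `x` (sum of second partial derivatives). -/
def lap (n : ℕ) (f : EuclideanSpace ℝ (Fin n) → ℝ) (x : EuclideanSpace ℝ (Fin n)) : ℝ :=
  ∑ i : Fin n, fderiv ℝ (fun y => fderiv ℝ f y (EuclideanSpace.single i 1)) x
    (EuclideanSpace.single i 1)

/-- `u` is a smooth ancient solution of the heat equation on `ℝⁿ × (-∞, 0]`:
it is smooth and satisfies `Δ_x u = ∂_t u` for all `t ≤ 0`. -/
def IsAncientHeat (n : ℕ) (u : EuclideanSpace ℝ (Fin n) × ℝ → ℝ) : Prop :=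
  ContDiff ℝ (⊤ : ℕ∞) u ∧ ∀ (x : EuclideanSpace ℝ (Fin n)) (t : ℝ), t ≤ 0 →
    lap n (fun y => u (y, t)) x = deriv (fun s => u (x, s)) t

/-- `u` belongs to `H^q(ℝⁿ × ℝ⁻)`: an ancient solution of the heat equation of
polynomial growth of degree at most `q`. -/
def InHq (n : ℕ) (q : ℝ) (u : EuclideanSpace ℝ (Fin n) × ℝ → ℝ) : Prop :=
  IsAncientHeat n u ∧ ∃ c₀ : ℝ, 0 < c₀ ∧
    ∀ (x : EuclideanSpace ℝ (Fin n)) (t : ℝ), t ≤ 0 →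
      |u (x, t)| ≤ c₀ * (‖x‖ + Real.sqrt |t| + 1) ^ q

/-- The truncated paraboloid `P_r(x₀,t₀) = {(y,s) : |y−x₀| + √|t₀−s| ≤ r, s ≤ t₀}`. -/
def Pb (n : ℕ) (r : ℝ) (x₀ : EuclideanSpace ℝ (Fin n)) (t₀ : ℝ) :
    Set (EuclideanSpace ℝ (Fin n) × ℝ) :=
  {p | dist p.1 x₀ + Real.sqrt |t₀ - p.2| ≤ r ∧ p.2 ≤ t₀}

open Filter Topology

/-- Derivative of `u` in the constant direction `w`. -/
def dirDeriv {F : Type*} [NormedAddCommGroup F] [NormedSpace ℝ F] (w : F) (u : F → ℝ) : F → ℝ :=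
  fun p => fderiv ℝ u p w

section DirDeriv

variable {F : Type*} [NormedAddCommGroup F] [NormedSpace ℝ F] {u : F → ℝ}

theorem contDiff_dirDeriv (hu : ContDiff ℝ (⊤ : ℕ∞) u) (w : F) :
    ContDiff ℝ (⊤ : ℕ∞) (dirDeriv w u) :=
  (hu.fderiv_right (m := (⊤ : ℕ∞)) (by simp)).clm_apply contDiff_const

theorem dirDeriv_comm (hu : ContDiff ℝ (⊤ : ℕ∞) u) (v w : F) :
    dirDeriv v (dirDeriv w u) = dirDeriv w (dirDeriv v u) := by
  funext p
  have hd : DifferentiableAt ℝ (fderiv ℝ u) p :=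
    ((hu.fderiv_right (m := (⊤ : ℕ∞)) (by simp)).differentiable (by simp)) p
  have key : ∀ a b : F, dirDeriv a (dirDeriv b u) p = fderiv ℝ (fderiv ℝ u) p a b := by
    intro a b
    change fderiv ℝ (fun y => fderiv ℝ u y b) p a = _
    rw [fderiv_clm_apply hd (differentiableAt_const b)]
    simp
  rw [key, key]
  exact (hu.contDiffAt.isSymmSndFDerivAt
    (by simpa using WithTop.coe_le_coe.2 (le_top (a := (2 : ℕ∞))))) v w

theorem hasDerivAt_line (hu : ContDiff ℝ (⊤ : ℕ∞) u) (p w : F) (s : ℝ) :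
    HasDerivAt (fun s : ℝ => u (p + s • w)) (dirDeriv w u (p + s • w)) s := by
  have h1 : HasDerivAt (fun s : ℝ => p + s • w) w s := by
    simpa using ((hasDerivAt_id s).smul_const w).const_add p
  exact ((hu.differentiable (by simp)) (p + s • w)).hasFDerivAt.comp_hasDerivAt s h1

theorem dirDeriv_eq_zero_of_eqOn_line (hu : ContDiff ℝ (⊤ : ℕ∞) u) {p w : F}
    (h : ∀ s : ℝ, u (p + s • w) = 0) : dirDeriv w u p = 0 := by
  have h1 := hasDerivAt_line hu p w 0
  simp only [h, zero_smul, add_zero] at h1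
  exact h1.unique (hasDerivAt_const _ _)

end DirDeriv

theorem nonpos_of_isLocalMax_of_hasDerivAt {g g' : ℝ → ℝ} {a g'' : ℝ} (hmax : IsLocalMax g a)
    (hg : ∀ s, HasDerivAt g (g' s) s) (hg' : HasDerivAt g' g'' a) : g'' ≤ 0 := by
  by_contra! hpos
  have hderiv : deriv g = g' := funext fun s => (hg s).deriv
  have h0 : g' a = 0 := hmax.hasDerivAt_eq_zero (hg a)
  have hmin : IsLocalMin g a := by
    apply isLocalMin_of_deriv_deriv_pos
    · rw [hderiv, hg'.deriv]; exact hpos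
    · rw [hderiv, h0]
    · exact (hg a).continuousAt
  have hconst : g =ᶠ[𝓝 a] fun _ => g a := by
    filter_upwards [hmax, hmin] with s h1 h2 using le_antisymm h1 h2
  have h1 : g' =ᶠ[𝓝 a] fun _ => 0 := by
    have := hconst.deriv
    rw [hderiv] at this
    simpa using this
  have := (hg'.congr_of_eventuallyEq h1.symm).unique (hasDerivAt_const a (0 : ℝ))
  exact hpos.ne' this

theorem nonneg_of_eventually_le_left {g : ℝ → ℝ} {a g' : ℝ} (hg : HasDerivAt g g' a)
    (h : ∀ᶠ s in 𝓝[<] a, g s ≤ g a) : 0 ≤ g' := by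
  have h1 := (hasDerivWithinAt_iff_tendsto_slope' (s := Set.Iio a) (by simp)).1
    (hg.hasDerivWithinAt (s := Set.Iio a))
  refine ge_of_tendsto h1 ?_
  filter_upwards [h, self_mem_nhdsWithin] with s hs hs'
  rw [slope_def_field]
  exact div_nonneg_of_nonpos (by linarith) (by simp only [Set.mem_Iio] at hs'; linarith)

/-- First derivative of the Bernstein quantity `H² V² + A U²`. -/
theorem hasDerivAt_bernstein {H V U : ℝ → ℝ} {H1 V1 U1 s : ℝ} (A : ℝ)
    (hH : HasDerivAt H H1 s) (hV : HasDerivAt V V1 s) (hU : HasDerivAt U U1 s) :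
    HasDerivAt (fun s => H s ^ 2 * V s ^ 2 + A * U s ^ 2)
      (2 * (H s * H1 * V s ^ 2 + H s ^ 2 * (V s * V1) + A * (U s * U1))) s := by
  refine (((hH.pow 2).mul (hV.pow 2)).add ((hU.pow 2).const_mul A)).congr_deriv ?_
  simp
  ring

/-- Second derivative test for the Bernstein quantity `H² V² + A U²`. -/
theorem bernstein_second_deriv_test {H V U H1 V1 U1 : ℝ → ℝ} {H2 V2 U2 a A : ℝ}
    (hH : ∀ s, HasDerivAt H (H1 s) s) (hV : ∀ s, HasDerivAt V (V1 s) s)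
    (hU : ∀ s, HasDerivAt U (U1 s) s) (hH1 : HasDerivAt H1 H2 a) (hV1 : HasDerivAt V1 V2 a)
    (hU1 : HasDerivAt U1 U2 a)
    (hmax : IsLocalMax (fun s => H s ^ 2 * V s ^ 2 + A * U s ^ 2) a) :
    (H1 a ^ 2 + H a * H2) * V a ^ 2 + 4 * (H a * H1 a * (V a * V1 a))
      + H a ^ 2 * (V1 a ^ 2 + V a * V2) + A * (U1 a ^ 2 + U a * U2) ≤ 0 := by
  have h := nonpos_of_isLocalMax_of_hasDerivAt hmax
    (fun s => hasDerivAt_bernstein A (hH s) (hV s) (hU s))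
    ((((((hH a).mul hH1).mul ((hV a).pow 2)).add (((hH a).pow 2).mul ((hV a).mul hV1))).add
      (((hU a).mul hU1).const_mul A)).const_mul 2)
  simp at h
  nlinarith [h]

section Heat

variable {n : ℕ} {u : EuclideanSpace ℝ (Fin n) × ℝ → ℝ}

/-- The `i`-th spatial unit vector in space-time. -/
def spaceDir (n : ℕ) (i : Fin n) : EuclideanSpace ℝ (Fin n) × ℝ := (EuclideanSpace.single i 1, 0)

/-- The unit time vector in space-time. -/
def timeDir (n : ℕ) : EuclideanSpace ℝ (Fin n) × ℝ := (0, 1)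

theorem fderiv_slice (hu : ContDiff ℝ (⊤ : ℕ∞) u) (t : ℝ) (y : EuclideanSpace ℝ (Fin n))
    (i : Fin n) : fderiv ℝ (fun y => u (y, t)) y (EuclideanSpace.single i 1) =
      dirDeriv (spaceDir n i) u (y, t) := by
  have h1 := ((hu.differentiable (by simp)) (y, t)).hasFDerivAt.comp y
    (hasFDerivAt_prodMk_left (𝕜 := ℝ) y t)
  have h2 : fderiv ℝ (fun y => u (y, t)) y = _ := h1.fderiv
  rw [h2]
  simp [dirDeriv, spaceDir]

theorem isAncientHeat_iff : IsAncientHeat n u ↔ ContDiff ℝ (⊤ : ℕ∞) u ∧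
    ∀ p : EuclideanSpace ℝ (Fin n) × ℝ, p.2 ≤ 0 →
      ∑ i, dirDeriv (spaceDir n i) (dirDeriv (spaceDir n i) u) p = dirDeriv (timeDir n) u p := by
  refine and_congr_right fun hu => ?_
  have hlap : ∀ x t, lap n (fun y => u (y, t)) x =
      ∑ i, dirDeriv (spaceDir n i) (dirDeriv (spaceDir n i) u) (x, t) := by
    intro x t
    refine Finset.sum_congr rfl fun i _ => ?_
    rw [← fderiv_slice (contDiff_dirDeriv hu _)]
    simp_rw [fderiv_slice hu t]
  have htime : ∀ x t, deriv (fun s => u (x, s)) t = dirDeriv (timeDir n) u (x, t) := by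
    intro x t
    have h1 := ((hu.differentiable (by simp)) (x, t)).hasFDerivAt.comp_hasDerivAt t
      ((hasDerivAt_const t x).prodMk (hasDerivAt_id t))
    exact h1.deriv
  simp_rw [hlap, htime]
  exact ⟨fun h p hp => h p.1 p.2 hp, fun h x t ht => h (x, t) ht⟩

theorem IsAncientHeat.dirDeriv_spaceDir (hu : IsAncientHeat n u) (j : Fin n) :
    IsAncientHeat n (dirDeriv (spaceDir n j) u) := by
  rw [isAncientHeat_iff] at hu ⊢
  obtain ⟨hs, hu⟩ := hu
  refine ⟨contDiff_dirDeriv hs _, fun p hp => ?_⟩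
  have hsum : ContDiff ℝ (⊤ : ℕ∞)
      (fun p => ∑ i, dirDeriv (spaceDir n i) (dirDeriv (spaceDir n i) u) p) :=
    ContDiff.sum fun i _ => contDiff_dirDeriv (contDiff_dirDeriv hs _) _
  have h1 : dirDeriv (spaceDir n j) (fun p => (∑ i, dirDeriv (spaceDir n i)
      (dirDeriv (spaceDir n i) u) p) - dirDeriv (timeDir n) u p) p = 0 := by
    refine dirDeriv_eq_zero_of_eqOn_line (hsum.sub (contDiff_dirDeriv hs _)) fun s => ?_
    exact sub_eq_zero.2 (hu _ (by simpa [spaceDir] using hp))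
  have h2 : dirDeriv (spaceDir n j) (fun p => (∑ i, dirDeriv (spaceDir n i)
      (dirDeriv (spaceDir n i) u) p) - dirDeriv (timeDir n) u p) p =
      (∑ i, dirDeriv (spaceDir n j) (dirDeriv (spaceDir n i) (dirDeriv (spaceDir n i) u)) p)
        - dirDeriv (spaceDir n j) (dirDeriv (timeDir n) u) p := by
    change fderiv ℝ (fun p => (∑ i, dirDeriv (spaceDir n i) (dirDeriv (spaceDir n i) u) p)
      - dirDeriv (timeDir n) u p) p (spaceDir n j) = _
    rw [fderiv_fun_sub (hsum.differentiable (by simp) p)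
      ((contDiff_dirDeriv hs (timeDir n)).differentiable (by simp) p),
      fderiv_fun_sum fun i _ => ((contDiff_dirDeriv (contDiff_dirDeriv hs (spaceDir n i))
        (spaceDir n i)).differentiable (by simp) p), sub_apply,
      sum_apply]
    rfl
  rw [h1] at h2
  rw [dirDeriv_comm hs (timeDir n), ← sub_eq_zero, h2]
  congr 1
  refine Finset.sum_congr rfl fun i _ => ?_
  rw [dirDeriv_comm hs (spaceDir n i) (spaceDir n j),
    dirDeriv_comm (contDiff_dirDeriv hs _) (spaceDir n i) (spaceDir n j)]

theorem norm_sq_add_single (y : EuclideanSpace ℝ (Fin n)) (i : Fin n) (s : ℝ) :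
    ‖y + s • EuclideanSpace.single i (1 : ℝ)‖ ^ 2 = ‖y‖ ^ 2 + 2 * s * y i + s ^ 2 := by
  rw [norm_add_sq_real, inner_smul_right, EuclideanSpace.inner_single_right, norm_smul]
  simp
  ring

/-- The first and second order conditions at an interior maximum of the Bernstein quantity
force the gradient component `v` to vanish there. -/
theorem bernstein_maximum_principle {y : EuclideanSpace ℝ (Fin n)} {r τ U v ut vt : ℝ}
    {ui uii vi vii : Fin n → ℝ} {j : Fin n} (hτ0 : 0 < τ) (hτr : τ ≤ r ^ 2)
    (hyr : ‖y‖ ^ 2 ≤ r ^ 2)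
    (hspace : ∀ i, ((-2 * y i * τ) ^ 2 + (r ^ 2 - ‖y‖ ^ 2) * τ * (-2 * τ)) * v ^ 2
      + 4 * ((r ^ 2 - ‖y‖ ^ 2) * τ * (-2 * y i * τ) * (v * vi i))
      + ((r ^ 2 - ‖y‖ ^ 2) * τ) ^ 2 * (vi i ^ 2 + v * vii i)
      + (14 + 2 * n) * r ^ 6 * (ui i ^ 2 + U * uii i) ≤ 0)
    (htime : 0 ≤ (r ^ 2 - ‖y‖ ^ 2) * τ * (r ^ 2 - ‖y‖ ^ 2) * v ^ 2
      + ((r ^ 2 - ‖y‖ ^ 2) * τ) ^ 2 * (v * vt) + (14 + 2 * n) * r ^ 6 * (U * ut))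
    (hv : ∑ i, vii i = vt) (hu : ∑ i, uii i = ut) (hj : ui j = v) : v = 0 := by
  by_contra hne
  have hvpos : 0 < v ^ 2 := by positivity
  have hr6 : 0 < r ^ 6 := by
    have : 0 < r ^ 2 := hτ0.trans_le hτr
    calc 0 < (r ^ 2) ^ 3 := by positivity
      _ = r ^ 6 := by ring
  set d := r ^ 2 - ‖y‖ ^ 2 with hd
  set A : ℝ := (14 + 2 * n) * r ^ 6 with hA
  have hApos : 0 < A := by positivity
  have hsum : ∑ i, ((-2 * y i * τ) ^ 2 + d * τ * (-2 * τ)) * v ^ 2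
      + ∑ i, (4 * (d * τ * (-2 * y i * τ) * (v * vi i)) + (d * τ) ^ 2 * vi i ^ 2)
      + (d * τ) ^ 2 * (v * vt) + A * ∑ i, ui i ^ 2 + A * (U * ut) ≤ 0 := by
    rw [← hu, ← hv]
    simp only [Finset.mul_sum, ← Finset.sum_add_distrib]
    refine Finset.sum_nonpos fun i _ => le_trans (le_of_eq ?_) (hspace i)
    ring
  have hcross : ∑ i, -4 * (-2 * y i * τ) ^ 2 * v ^ 2 ≤
      ∑ i, (4 * (d * τ * (-2 * y i * τ) * (v * vi i)) + (d * τ) ^ 2 * vi i ^ 2) := by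
    refine Finset.sum_le_sum fun i _ => ?_
    linarith [sq_nonneg (d * τ * vi i + 2 * ((-2 * y i * τ) * v))]
  have hgrad : v ^ 2 ≤ ∑ i, ui i ^ 2 := by
    rw [← hj]
    exact Finset.single_le_sum (f := fun i => ui i ^ 2) (fun i _ => sq_nonneg _)
      (Finset.mem_univ j)
  have hnorm : ∑ i, y i ^ 2 = ‖y‖ ^ 2 := by
    rw [EuclideanSpace.norm_sq_eq]; simp
  have e1 : ∑ i, ((-2 * y i * τ) ^ 2 + d * τ * (-2 * τ)) * v ^ 2 =
      (4 * τ ^ 2 * ‖y‖ ^ 2 + n * (d * τ * (-2 * τ))) * v ^ 2 := by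
    rw [← Finset.sum_mul, Finset.sum_add_distrib, ← hnorm, Finset.mul_sum]
    simp only [Finset.sum_const, Finset.card_univ, Fintype.card_fin, nsmul_eq_mul]
    congr 2
    exact Finset.sum_congr rfl fun i _ => by ring
  have e2 : ∑ i, -4 * (-2 * y i * τ) ^ 2 * v ^ 2 = -(16 * τ ^ 2 * ‖y‖ ^ 2) * v ^ 2 := by
    rw [← Finset.sum_mul, ← hnorm, Finset.mul_sum, ← Finset.sum_neg_distrib]
    congr 1
    exact Finset.sum_congr rfl fun i _ => by ring
  have hkey : (A - 12 * (τ ^ 2 * ‖y‖ ^ 2) - 2 * n * (d * τ ^ 2) - d ^ 2 * τ) * v ^ 2 ≤ 0 := by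
    linarith [mul_le_mul_of_nonneg_left hgrad hApos.le]
  have hcoef : 0 < A - 12 * (τ ^ 2 * ‖y‖ ^ 2) - 2 * n * (d * τ ^ 2) - d ^ 2 * τ := by
    have hd0 : 0 ≤ d := by linarith
    have hdr : d ≤ r ^ 2 := by linarith [sq_nonneg ‖y‖]
    have b1 : τ ^ 2 * ‖y‖ ^ 2 ≤ r ^ 6 := by
      calc τ ^ 2 * ‖y‖ ^ 2 ≤ (r ^ 2) ^ 2 * r ^ 2 := by gcongr
        _ = r ^ 6 := by ring
    have b2 : 2 * n * (d * τ ^ 2) ≤ 2 * n * r ^ 6 := by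
      calc 2 * n * (d * τ ^ 2) ≤ 2 * n * (r ^ 2 * (r ^ 2) ^ 2) := by gcongr
        _ = 2 * n * r ^ 6 := by ring
    have b3 : d ^ 2 * τ ≤ r ^ 6 := by
      calc d ^ 2 * τ ≤ (r ^ 2) ^ 2 * r ^ 2 := by gcongr
        _ = r ^ 6 := by ring
    rw [hA]
    linarith
  exact absurd hkey (not_le.2 (mul_pos hcoef hvpos))

/-- Bernstein's interior gradient estimate for the heat equation. -/
theorem IsAncientHeat.gradient_estimate (hu : IsAncientHeat n u) (j : Fin n)
    {x₀ : EuclideanSpace ℝ (Fin n)} {t₀ r M : ℝ} (ht₀ : t₀ ≤ 0) (hr : 0 < r)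
    (hM : ∀ x t, ‖x - x₀‖ ≤ r → t₀ - r ^ 2 ≤ t → t ≤ t₀ → |u (x, t)| ≤ M) :
    r ^ 2 * dirDeriv (spaceDir n j) u (x₀, t₀) ^ 2 ≤ (14 + 2 * n) * M ^ 2 := by
  have hv := isAncientHeat_iff.1 (hu.dirDeriv_spaceDir j)
  obtain ⟨hus, hue⟩ := isAncientHeat_iff.1 hu
  obtain ⟨hvs, hve⟩ := hv
  set v := dirDeriv (spaceDir n j) u
  set A : ℝ := (14 + 2 * n) * r ^ 6 with hA
  set η : EuclideanSpace ℝ (Fin n) × ℝ → ℝ :=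
    fun p => (r ^ 2 - ‖p.1 - x₀‖ ^ 2) * (p.2 - t₀ + r ^ 2) with hη
  set G : EuclideanSpace ℝ (Fin n) × ℝ → ℝ := fun p => η p ^ 2 * v p ^ 2 + A * u p ^ 2 with hG
  have hM0 : 0 ≤ M := (abs_nonneg _).trans (hM x₀ t₀ (by simpa using hr.le) (by nlinarith) le_rfl)
  have hApos : 0 < A := by positivity
  have hηc : Continuous η := by fun_prop
  have hGc : Continuous G := by
    have := hus.continuous
    have := hvs.continuous
    fun_prop
  suffices hmain : G (x₀, t₀) ≤ A * M ^ 2 by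
    have h0 : η (x₀, t₀) = r ^ 4 := by simp [hη]; ring
    have h1 : r ^ 8 * v (x₀, t₀) ^ 2 ≤ A * M ^ 2 := by
      have : G (x₀, t₀) = r ^ 8 * v (x₀, t₀) ^ 2 + A * u (x₀, t₀) ^ 2 := by
        simp only [hG, h0]; ring
      nlinarith [mul_nonneg hApos.le (sq_nonneg (u (x₀, t₀)))]
    have h6 : 0 < r ^ 6 := by positivity
    refine le_of_mul_le_mul_left ?_ h6
    calc r ^ 6 * (r ^ 2 * v (x₀, t₀) ^ 2) = r ^ 8 * v (x₀, t₀) ^ 2 := by ring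
      _ ≤ _ := h1
      _ = _ := by rw [hA]; ring
  obtain ⟨⟨x, t⟩, ⟨hxK, htK⟩, hmaxK⟩ :=
    ((isCompact_closedBall x₀ r).prod (isCompact_Icc (a := t₀ - r ^ 2) (b := t₀))).exists_isMaxOn
      ⟨(x₀, t₀), by simp [hr.le]⟩ hGc.continuousOn
  by_contra! hlt
  rw [mem_closedBall_iff_norm] at hxK
  simp only at hxK htK
  have hGmax : A * M ^ 2 < G (x, t) :=
    hlt.trans_le (hmaxK (show (x₀, t₀) ∈ _ by simp [hr.le]))
  have huM : u (x, t) ^ 2 ≤ M ^ 2 := sq_le_sq'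
    (by linarith [neg_le_of_abs_le (hM x t hxK htK.1 htK.2)])
    (le_of_abs_le (hM x t hxK htK.1 htK.2))
  have hpos : 0 < η (x, t) ^ 2 * v (x, t) ^ 2 := by
    simp only [hG] at hGmax
    nlinarith
  have hηne : η (x, t) ≠ 0 := fun h => by simp [h] at hpos
  have hvpos : 0 < v (x, t) ^ 2 := by
    have : v (x, t) ≠ 0 := fun h => by simp [h] at hpos
    positivity
  have hxlt : ‖x - x₀‖ < r := by
    refine lt_of_le_of_ne hxK fun h => hηne ?_
    simp [hη, h]
  have htlt : t₀ - r ^ 2 < t := by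
    refine lt_of_le_of_ne htK.1 fun h => hηne ?_
    simp [hη, ← h]
  set y := x - x₀ with hy
  set τ := t - t₀ + r ^ 2 with hτ
  have hτ0 : 0 < τ := by linarith
  have hτr : τ ≤ r ^ 2 := by linarith [htK.2]
  have hyr : ‖y‖ ^ 2 ≤ r ^ 2 := by gcongr
  have hspace : ∀ i, ((-2 * y i * τ) ^ 2 + η (x, t) * (-2 * τ)) * v (x, t) ^ 2
      + 4 * (η (x, t) * (-2 * y i * τ) * (v (x, t) * dirDeriv (spaceDir n i) v (x, t)))
      + η (x, t) ^ 2 * (dirDeriv (spaceDir n i) v (x, t) ^ 2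
        + v (x, t) * dirDeriv (spaceDir n i) (dirDeriv (spaceDir n i) v) (x, t))
      + A * (dirDeriv (spaceDir n i) u (x, t) ^ 2
        + u (x, t) * dirDeriv (spaceDir n i) (dirDeriv (spaceDir n i) u) (x, t)) ≤ 0 := by
    intro i
    have hline : ∀ s : ℝ, η ((x, t) + s • spaceDir n i) =
        (r ^ 2 - (‖y‖ ^ 2 + 2 * s * y i + s ^ 2)) * τ := by
      intro s
      simp only [hη, spaceDir, Prod.smul_mk, Prod.mk_add_mk, smul_zero, add_zero]
      rw [add_sub_right_comm, norm_sq_add_single]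
    have hmax : IsLocalMax (fun s : ℝ => G ((x, t) + s • spaceDir n i)) 0 := by
      have hc : Tendsto (fun s : ℝ => ‖x + s • EuclideanSpace.single i (1 : ℝ) - x₀‖) (𝓝 0)
          (𝓝 ‖y‖) := by
        have : Continuous (fun s : ℝ => ‖x + s • EuclideanSpace.single i (1 : ℝ) - x₀‖) := by
          fun_prop
        simpa [hy] using this.tendsto 0
      filter_upwards [hc.eventually_lt_const hxlt] with s hs
      simp only [zero_smul, add_zero]
      refine hmaxK ⟨?_, ?_⟩
      · rw [mem_closedBall_iff_norm]
        simpa [spaceDir] using hs.le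
      · simpa [spaceDir] using htK
    have hH : ∀ s : ℝ, HasDerivAt (fun s : ℝ => η ((x, t) + s • spaceDir n i))
        ((-2 * y i - 2 * s) * τ) s := by
      intro s
      simp_rw [hline]
      have h1 : HasDerivAt (fun s : ℝ => (r ^ 2 - (‖y‖ ^ 2 + 2 * s * y i + s ^ 2)) * τ)
          (-(2 * 1 * y i + (2 : ℕ) * s ^ (2 - 1) * 1) * τ) s :=
        ((((((hasDerivAt_id s).const_mul 2).mul_const (y i)).const_add (‖y‖ ^ 2)).add
          ((hasDerivAt_id s).pow 2)).const_sub (r ^ 2)).mul_const τ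
      refine h1.congr_deriv ?_
      push_cast
      ring
    have hH1 : HasDerivAt (fun s : ℝ => (-2 * y i - 2 * s) * τ) (-2 * τ) 0 := by
      refine ((((hasDerivAt_id (0 : ℝ)).const_mul 2).const_sub (-2 * y i)).mul_const
        τ).congr_deriv ?_
      ring
    have := bernstein_second_deriv_test (A := A) hH (hasDerivAt_line hvs (x, t) (spaceDir n i))
      (hasDerivAt_line hus (x, t) (spaceDir n i)) hH1
      (hasDerivAt_line (contDiff_dirDeriv hvs _) (x, t) (spaceDir n i) 0)
      (hasDerivAt_line (contDiff_dirDeriv hus _) (x, t) (spaceDir n i) 0) hmax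
    simpa using this
  have htime : 0 ≤ η (x, t) * (r ^ 2 - ‖y‖ ^ 2) * v (x, t) ^ 2
      + η (x, t) ^ 2 * (v (x, t) * dirDeriv (timeDir n) v (x, t))
      + A * (u (x, t) * dirDeriv (timeDir n) u (x, t)) := by
    have hH : HasDerivAt (fun s : ℝ => η ((x, t) + s • timeDir n)) (r ^ 2 - ‖y‖ ^ 2) 0 := by
      simp only [hη, timeDir, Prod.smul_mk, Prod.mk_add_mk, smul_zero, add_zero, smul_eq_mul,
        mul_one]
      refine (((((hasDerivAt_id (0 : ℝ)).const_add t).sub_const t₀).add_const (r ^ 2)).const_mul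
        (r ^ 2 - ‖x - x₀‖ ^ 2)).congr_deriv ?_
      simp [hy]
    have h := nonneg_of_eventually_le_left (hasDerivAt_bernstein A hH
      (hasDerivAt_line hvs (x, t) (timeDir n) 0) (hasDerivAt_line hus (x, t) (timeDir n) 0)) (by
        have : ∀ᶠ s : ℝ in 𝓝[<] 0, t₀ - r ^ 2 - t < s :=
          nhdsWithin_le_nhds (eventually_gt_nhds (by linarith))
        filter_upwards [this, self_mem_nhdsWithin] with s hs hs'
        rw [Set.mem_Iio] at hs'
        have : (x, t) + s • timeDir n ∈ Metric.closedBall x₀ r ×ˢ Set.Icc (t₀ - r ^ 2) t₀ := by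
          refine ⟨?_, ?_⟩
          · rw [mem_closedBall_iff_norm]
            simpa [timeDir] using hxK
          · simp only [timeDir, Prod.smul_mk, Prod.mk_add_mk, smul_eq_mul, mul_one]
            exact ⟨by linarith, by linarith [htK.2]⟩
        simpa using hmaxK this)
    simp only [zero_smul, add_zero] at h
    linarith
  have ht0 : t ≤ 0 := htK.2.trans ht₀
  exact hvpos.ne' (pow_eq_zero_iff two_ne_zero |>.2
    (bernstein_maximum_principle hτ0 hτr hyr hspace htime (hve (x, t) ht0) (hue (x, t) ht0)
      (j := j) rfl))

theorem IsAncientHeat.dirDeriv_eq_zero_of_bounded (hu : IsAncientHeat n u) {c : ℝ}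
    (hc : ∀ x t, t ≤ 0 → |u (x, t)| ≤ c) (j : Fin n)
    (x : EuclideanSpace ℝ (Fin n)) {t : ℝ} (ht : t ≤ 0) :
    dirDeriv (spaceDir n j) u (x, t) = 0 := by
  by_contra hne
  have hpos : 0 < dirDeriv (spaceDir n j) u (x, t) ^ 2 := by positivity
  have h : ∀ r : ℝ, 0 < r →
      r ^ 2 * dirDeriv (spaceDir n j) u (x, t) ^ 2 ≤ (14 + 2 * n) * c ^ 2 := fun r hr =>
    hu.gradient_estimate j ht hr fun y s _ _ hs => hc y s (hs.trans ht)
  have hB : 0 ≤ (14 + 2 * (n : ℝ)) * c ^ 2 := by positivity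
  have hlim : Tendsto (fun r : ℝ => r ^ 2 * dirDeriv (spaceDir n j) u (x, t) ^ 2) atTop atTop :=
    (tendsto_pow_atTop two_ne_zero).atTop_mul_const hpos
  obtain ⟨r, hr, hr0⟩ :=
    ((hlim.eventually_gt_atTop ((14 + 2 * (n : ℝ)) * c ^ 2)).and (eventually_gt_atTop 0)).exists
  exact absurd (h r hr0) (not_le.2 hr)

theorem IsAncientHeat.dirDeriv_growth (hu : IsAncientHeat n u) {c : ℝ} (hc0 : 0 ≤ c) {N : ℕ}
    (hc : ∀ x t, t ≤ 0 → |u (x, t)| ≤ c * (‖x‖ + √|t| + 1) ^ (N + 1)) (j : Fin n) :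
    ∃ c' : ℝ, 0 ≤ c' ∧ ∀ x t, t ≤ 0 →
      |dirDeriv (spaceDir n j) u (x, t)| ≤ c' * (‖x‖ + √|t| + 1) ^ N := by
  refine ⟨√(14 + 2 * n) * c * 5 ^ (N + 1), by positivity, fun x t ht => ?_⟩
  set ρ := ‖x‖ + √|t| + 1 with hρ
  have hxρ : ‖x‖ ≤ ρ := by linarith [sqrt_nonneg |t|]
  have htρ : √|t| ≤ ρ := by linarith [norm_nonneg x]
  have h1ρ : 1 ≤ ρ := by linarith [norm_nonneg x, sqrt_nonneg |t|]
  have hρ0 : 0 < ρ := by linarith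
  have h := hu.gradient_estimate j (x₀ := x) (M := c * (5 * ρ) ^ (N + 1)) ht hρ0 (by
    intro y s hy hs1 hs2
    refine (hc y s (hs2.trans ht)).trans ?_
    gcongr
    have h1 : ‖y‖ ≤ 2 * ρ := by
      have := norm_le_norm_add_norm_sub' y x
      linarith
    have h2 : √|s| ≤ 2 * ρ := by
      refine sqrt_le_iff.2 ⟨by positivity, ?_⟩
      have h3 : |t| ≤ ρ ^ 2 := by
        rw [← sq_sqrt (abs_nonneg t)]; gcongr
      rw [abs_of_nonpos ht] at h3
      rw [abs_of_nonpos (hs2.trans ht)]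
      nlinarith
    linarith)
  refine abs_le_of_sq_le_sq ?_ (by positivity)
  have h2 : (0 : ℝ) < ρ ^ 2 := by positivity
  refine le_of_mul_le_mul_left (h.trans (le_of_eq ?_)) h2
  have h3 : √(14 + 2 * (n : ℝ)) ^ 2 = 14 + 2 * n := sq_sqrt (by positivity)
  simp only [mul_pow, h3]
  ring

theorem IsAncientHeat.eq_of_dirDeriv_eq_zero (hu : IsAncientHeat n u)
    (h : ∀ j x t, t ≤ 0 → dirDeriv (spaceDir n j) u (x, t) = 0)
    {p p' : EuclideanSpace ℝ (Fin n) × ℝ} (hp : p.2 ≤ 0) (hp' : p'.2 ≤ 0) : u p = u p' := by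
  obtain ⟨hs, he⟩ := isAncientHeat_iff.1 hu
  have hfd : ∀ p ∈ {p : EuclideanSpace ℝ (Fin n) × ℝ | p.2 ≤ 0}, ‖fderiv ℝ u p‖ ≤ 0 := by
    intro p hp
    have htime : fderiv ℝ u p (timeDir n) = 0 := by
      have h1 := he p hp
      rw [Finset.sum_eq_zero] at h1
      · exact h1.symm
      · intro i _
        refine dirDeriv_eq_zero_of_eqOn_line (contDiff_dirDeriv hs _) fun s => h i _ _ ?_
        simpa [spaceDir] using hp
    have : fderiv ℝ u p = 0 := by
      ext w
      · have : ∀ w : EuclideanSpace ℝ (Fin n), fderiv ℝ u p (w, 0) = 0 := by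
          intro w
          have hw : (w, (0 : ℝ)) = ∑ i, w i • spaceDir n i := by
            have hb := (EuclideanSpace.basisFun (Fin n) ℝ).sum_repr w
            simp only [EuclideanSpace.basisFun_repr, EuclideanSpace.basisFun_apply] at hb
            refine Prod.ext ?_ ?_
            · rw [Prod.fst_sum]; simpa [spaceDir] using hb.symm
            · rw [Prod.snd_sum]; simp [spaceDir]
          rw [hw, map_sum]
          refine Finset.sum_eq_zero fun i _ => ?_
          rw [map_smul]
          simp [show fderiv ℝ u p (spaceDir n i) = 0 from h i p.1 p.2 hp]
        simpa using this _
      · simpa [timeDir] using htime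
    simp [this]
  have hconv : Convex ℝ {p : EuclideanSpace ℝ (Fin n) × ℝ | p.2 ≤ 0} :=
    convex_halfSpace_le (LinearMap.snd ℝ _ ℝ).isLinear 0
  have := hconv.norm_image_sub_le_of_norm_fderiv_le
    (fun x _ => hs.differentiable (by simp) x) hfd hp' hp
  rw [zero_mul] at this
  exact sub_eq_zero.1 (norm_le_zero_iff.1 this)

/-- Unique continuation for ancient solutions of polynomial growth. -/
theorem IsAncientHeat.eq_zero_of_eqOn_open {O : Set (EuclideanSpace ℝ (Fin n) × ℝ)}
    (hO : IsOpen O) (hne : O.Nonempty) (hOt : ∀ p ∈ O, p.2 ≤ 0) (N : ℕ) {c : ℝ} (hc0 : 0 ≤ c)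
    (hu : IsAncientHeat n u) (hc : ∀ x t, t ≤ 0 → |u (x, t)| ≤ c * (‖x‖ + √|t| + 1) ^ N)
    (hz : ∀ p ∈ O, u p = 0) {p : EuclideanSpace ℝ (Fin n) × ℝ} (hp : p.2 ≤ 0) : u p = 0 := by
  obtain ⟨p', hp'⟩ := hne
  rw [← hz p' hp']
  refine hu.eq_of_dirDeriv_eq_zero (fun j x t ht => ?_) hp (hOt p' hp')
  induction N generalizing u c p j x t with
  | zero => exact hu.dirDeriv_eq_zero_of_bounded (by simpa using hc) j x ht
  | succ N ih =>
    obtain ⟨c', hc', hgrow⟩ := hu.dirDeriv_growth hc0 hc j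
    have hzj : ∀ p ∈ O, dirDeriv (spaceDir n j) u p = 0 := by
      intro p hpO
      have : u =ᶠ[𝓝 p] fun _ => 0 := by
        filter_upwards [hO.mem_nhds hpO] with q hq using hz q hq
      simp [dirDeriv, this.fderiv_eq]
    rw [← hzj p' hp']
    exact (hu.dirDeriv_spaceDir j).eq_of_dirDeriv_eq_zero
      (fun i y s hs => ih hc' (hu.dirDeriv_spaceDir j) hgrow hzj (p := p) hp i y s hs) ht
      (hOt p' hp')

theorem isCompact_Pb (r : ℝ) (x₀ : EuclideanSpace ℝ (Fin n)) (t₀ : ℝ) :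
    IsCompact (Pb n r x₀ t₀) := by
  have hc : Continuous fun p : EuclideanSpace ℝ (Fin n) × ℝ => dist p.1 x₀ + √|t₀ - p.2| := by
    fun_prop
  have hclosed : IsClosed (Pb n r x₀ t₀) :=
    (isClosed_le hc continuous_const).inter (isClosed_le continuous_snd continuous_const)
  refine ((isCompact_closedBall x₀ r).prod
    (isCompact_Icc (a := t₀ - r ^ 2) (b := t₀))).of_isClosed_subset hclosed ?_
  rintro ⟨x, t⟩ ⟨h1, h2⟩
  simp only at h1 h2
  refine ⟨?_, ?_, h2⟩
  · rw [Metric.mem_closedBall]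
    linarith [sqrt_nonneg |t₀ - t|]
  · have h3 : √|t₀ - t| ≤ r := by linarith [dist_nonneg (x := x) (y := x₀)]
    have h4 := (sqrt_le_iff.1 h3).2
    linarith [le_abs_self (t₀ - t)]

/-- A continuous function whose square has zero integral over a paraboloid vanishes on its
interior. -/
theorem eq_zero_of_integral_Pb_sq_eq_zero (hu : Continuous u) {r t₀ : ℝ}
    {x₀ : EuclideanSpace ℝ (Fin n)} (h : (∫ p in Pb n r x₀ t₀, (u p) ^ 2) = 0) :
    ∀ p ∈ interior (Pb n r x₀ t₀), u p = 0 := by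
  have hc : Continuous fun p => u p ^ 2 := hu.pow 2
  rw [setIntegral_eq_zero_iff_of_nonneg_ae (Eventually.of_forall fun p => sq_nonneg (u p))
    (hc.continuousOn.integrableOn_compact (isCompact_Pb r x₀ t₀))] at h
  intro p hp
  have := Measure.eqOn_open_of_ae_eq (ae_restrict_of_ae_restrict_of_subset interior_subset h)
    isOpen_interior hc.continuousOn continuousOn_const hp
  exact pow_eq_zero_iff two_ne_zero |>.1 this

theorem nonempty_interior_Pb {r : ℝ} (hr : 0 < r) (x₀ : EuclideanSpace ℝ (Fin n)) (t₀ : ℝ) :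
    (interior (Pb n r x₀ t₀)).Nonempty := by
  have hc : Continuous fun p : EuclideanSpace ℝ (Fin n) × ℝ => dist p.1 x₀ + √|t₀ - p.2| := by
    fun_prop
  have hopen : IsOpen {p : EuclideanSpace ℝ (Fin n) × ℝ |
      dist p.1 x₀ + √|t₀ - p.2| < r ∧ p.2 < t₀} :=
    (isOpen_lt hc continuous_const).inter (isOpen_lt continuous_snd continuous_const)
  refine ⟨(x₀, t₀ - (r / 2) ^ 2), mem_interior.2
    ⟨_, fun p hp => ⟨hp.1.le, hp.2.le⟩, hopen, ?_, ?_⟩⟩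
  · have : (0 : ℝ) ≤ r / 2 := by positivity
    simp only [dist_self, sub_sub_cancel, abs_of_nonneg (sq_nonneg (r / 2)), sqrt_sq this, zero_add]
    linarith
  · have : 0 < (r / 2) ^ 2 := by positivity
    simp only
    linarith

theorem IsAncientHeat.eq_zero_of_integral_Pb_sq_eq_zero {q c₀ : ℝ} (hu : IsAncientHeat n u)
    (hc₀ : 0 < c₀) (hc : ∀ x t, t ≤ 0 → |u (x, t)| ≤ c₀ * (‖x‖ + √|t| + 1) ^ q)
    {R : ℝ} (hR : 0 < R) {x₀ : EuclideanSpace ℝ (Fin n)} {t₀ : ℝ} (ht₀ : t₀ ≤ 0)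
    (h : (∫ p in Pb n R x₀ t₀, (u p) ^ 2) = 0) (x : EuclideanSpace ℝ (Fin n)) {t : ℝ}
    (ht : t ≤ 0) : u (x, t) = 0 := by
  refine IsAncientHeat.eq_zero_of_eqOn_open isOpen_interior (nonempty_interior_Pb hR x₀ t₀)
    (fun p hp => (interior_subset hp).2.trans ht₀) ⌈q⌉₊ hc₀.le hu (fun y s hs => ?_)
    (_root_.eq_zero_of_integral_Pb_sq_eq_zero hu.1.continuous h) ht
  refine (hc y s hs).trans ?_
  rw [← rpow_natCast]
  gcongr
  · linarith [norm_nonneg y, sqrt_nonneg |s|]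
  · exact Nat.le_ceil q

end Heat

/-- if an ancient solution of the heat equation on `ℝⁿ × (-∞,0]` of
polynomial growth of degree at most `q ≥ 1` satisfies `∫_{P_R(x₀,t₀)} u² = 0` for some
`R > 0` and some `(x₀,t₀)`, then `u ≡ 0` on `ℝⁿ × (-∞,0]`. In particular, for every
`R > 0` and `(x₀,t₀)`, the form `(u,v) ↦ ∫_{P_R(x₀,t₀)} u v` is an inner product on any
finite-dimensional subspace of `H^q(ℝⁿ × ℝ⁻)`. -/
theorem Hq_paraboloid_inner_product_all_R (n : ℕ) (q : ℝ) (hq : 1 ≤ q) :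
    (∀ (u : EuclideanSpace ℝ (Fin n) × ℝ → ℝ) (c₀ : ℝ), 0 < c₀ →
      IsAncientHeat n u →
      (∀ (x : EuclideanSpace ℝ (Fin n)) (t : ℝ), t ≤ 0 →
        |u (x, t)| ≤ c₀ * (‖x‖ + Real.sqrt |t| + 1) ^ q) →
      ∀ R : ℝ, 0 < R → ∀ (x₀ : EuclideanSpace ℝ (Fin n)) (t₀ : ℝ), t₀ ≤ 0 →
        (∫ p in Pb n R x₀ t₀, (u p) ^ 2) = 0 →
        ∀ (x : EuclideanSpace ℝ (Fin n)) (t : ℝ), t ≤ 0 → u (x, t) = 0) ∧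
    (∀ K : Submodule ℝ (EuclideanSpace ℝ (Fin n) × ℝ → ℝ),
      FiniteDimensional ℝ K → (∀ u ∈ K, InHq n q u) →
      ∀ R : ℝ, 0 < R → ∀ (x₀ : EuclideanSpace ℝ (Fin n)) (t₀ : ℝ), t₀ ≤ 0 →
        ∀ u ∈ K, (∫ p in Pb n R x₀ t₀, (u p) ^ 2) = 0 →
          ∀ (x : EuclideanSpace ℝ (Fin n)) (t : ℝ), t ≤ 0 → u (x, t) = 0) := by
  refine ⟨fun u c₀ hc₀ hu hc R hR x₀ t₀ ht₀ h x t ht =>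
    hu.eq_zero_of_integral_Pb_sq_eq_zero hc₀ hc hR ht₀ h x ht, ?_⟩
  intro K _ hK R hR x₀ t₀ ht₀ u huK h x t ht
  obtain ⟨hu, c₀, hc₀, hc⟩ := hK u huK
  exact hu.eq_zero_of_integral_Pb_sq_eq_zero hc₀ hc hR ht₀ h x ht
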